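/- arXiv:1312.6798 — 2 statements merged into one kernel-verified Lean document; each statement's English description precedes it below -/
import Mathlib

section
/- Let A ⊆ B be a (φ,ψ)-bounded extension of the multi-filtered K-algebra A. Then the family 𝔉 = { F̃_α(B) : α ∈ ℕ^n }, where F̃_α(B) = Σ_{wt(γ) ⪯ α} F_{γ₁}(A)x^{γ₂}, is an (ℕ^n,⪯)-filtration on B: F̃_α(B) ⊆ F̃_β(B) whenever α ⪯ β, F̃_γ(B)F̃_δ(B) ⊆ F̃_{γ+δ}(B) for all γ,δ ∈ ℕ^n, ⋃_{α∈ℕ^n} F̃_α(B) = B, and 1 ∈ F̃_0(B). -/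
open scoped BigOperators

/-- Multi-indices: elements of `ℕ^n`. -/
abbrev MIdx (n : ℕ) := Fin n → ℕ

/-- An admissible order on `ℕ^n`: a total order compatible with addition and having `0` as
least element. -/
structure AdmOrder (n : ℕ) where
  le : MIdx n → MIdx n → Prop
  le_refl : ∀ a, le a a
  le_trans : ∀ {a b c}, le a b → le b c → le a c
  le_antisymm : ∀ {a b}, le a b → le b a → a = b
  le_total : ∀ a b, le a b ∨ le b a
  add_right : ∀ {a b : MIdx n} (c : MIdx n), le a b → le (a + c) (b + c)
  zero_le : ∀ a, le 0 a

/-- The strict order associated to an admissible order. -/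
def AdmOrder.lt {n : ℕ} (o : AdmOrder n) (a b : MIdx n) : Prop :=
  o.le a b ∧ a ≠ b

/-- The ordered standard monomial `x^β = x₁^{β₁} ⋯ x_s^{β_s}`. -/
def smon {B : Type*} [Monoid B] {s : ℕ} (x : Fin s → B) (β : MIdx s) : B :=
  (List.ofFn fun i => x i ^ β i).prod

/-- The `K`-submodule `Σ_{γ with P γ} F_{γ₁}(A)·x^{γ₂}` of `B`. -/
def monSum (K : Type*) [CommRing K] (B : Type*) [Ring B] [Algebra K B]
    {m s : ℕ} (F : MIdx m → Submodule K B) (x : Fin s → B)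
    (P : MIdx m × MIdx s → Prop) : Submodule K B :=
  ⨆ γ ∈ {γ : MIdx m × MIdx s | P γ},
    (F γ.1).map (LinearMap.mulRight K (smon x γ.2))

/-- A `(φ,ψ)`-bounded extension `A ⊆ B` of a multi-filtered `K`-algebra `A`, where `A` is
realized as a subalgebra of `B` carrying an `(ℕ^m,⪯₁)`-filtration `F`, and `B` is generated
over `A` by elements `x 1, …, x s`, subject to the axioms (EA1)–(EA4). -/
structure BoundedExt (K : Type*) [CommRing K] (B : Type*) [Ring B] [Algebra K B]
    (m s n : ℕ) where
  /-- admissible order `⪯₁` on `ℕ^m` -/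
  o1 : AdmOrder m
  /-- admissible order `⪯₂` on `ℕ^s` -/
  o2 : AdmOrder s
  /-- admissible order `⪯` on `ℕ^n` -/
  o : AdmOrder n
  /-- the monoid morphism `φ : ℕ^m → ℕ^n` -/
  φ : MIdx m →+ MIdx n
  /-- the monoid morphism `ψ : ℕ^s → ℕ^n` -/
  ψ : MIdx s →+ MIdx n
  φ_mono : ∀ {a b : MIdx m}, o1.le a b → o.le (φ a) (φ b)
  ψ_mono : ∀ {a b : MIdx s}, o2.le a b → o.le (ψ a) (ψ b)
  /-- the subalgebra `A` of `B` -/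
  A : Subalgebra K B
  /-- (EA1): the `(ℕ^m,⪯₁)`-filtration on `A` -/
  F : MIdx m → Submodule K B
  F_le_A : ∀ a : MIdx m, F a ≤ Subalgebra.toSubmodule A
  F_mono : ∀ {a b : MIdx m}, o1.le a b → F a ≤ F b
  F_mul : ∀ {a b : MIdx m} {u v : B}, u ∈ F a → v ∈ F b → u * v ∈ F (a + b)
  F_exhaustive : ∀ u ∈ A, ∃ a : MIdx m, u ∈ F a
  F_one : (1 : B) ∈ F 0
  /-- the generators `x_1, …, x_s` -/
  x : Fin s → B
  /-- (EA2): `B` is generated as a `K`-algebra by `A` and `x_1, …, x_s` -/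
  gen : Algebra.adjoin K ((A : Set B) ∪ Set.range x) = ⊤
  /-- (EA3) -/
  EA3 : ∀ (i : Fin s) (α : MIdx m), ∀ a ∈ F α,
    x i * a ∈ (F α).map (LinearMap.mulRight K (x i)) ⊔
      monSum K B F x (fun γ => o.lt (φ γ.1 + ψ γ.2) (φ α + ψ (Pi.single i 1)))
  /-- (EA4) -/
  EA4 : ∀ i j : Fin s, i < j → ∃ q ∈ F 0,
    x j * x i - q * (x i * x j) ∈
      monSum K B F x (fun γ => o.lt (φ γ.1 + ψ γ.2) (ψ (Pi.single i 1 + Pi.single j 1)))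

namespace BoundedExt

variable {K : Type*} [CommRing K] {B : Type*} [Ring B] [Algebra K B] {m s n : ℕ}

/-- The weight `wt(γ) = φ(γ₁) + ψ(γ₂)` of a pair of multi-indices. -/
def wt (E : BoundedExt K B m s n) (γ : MIdx m × MIdx s) : MIdx n :=
  E.φ γ.1 + E.ψ γ.2

/-- The filtration `F̃_α(B) = Σ_{wt(γ) ⪯ α} F_{γ₁}(A)x^{γ₂}` on `B`. -/
def tF (E : BoundedExt K B m s n) (α : MIdx n) : Submodule K B :=
  monSum K B E.F E.x (fun γ => E.o.le (E.wt γ) α)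

/-- `F̃_{≺α}(B) = ⋃_{β ≺ α} F̃_β(B)`. -/
def tFlt (E : BoundedExt K B m s n) (α : MIdx n) : Submodule K B :=
  ⨆ β ∈ {β : MIdx n | E.o.lt β α}, E.tF β

/-- `F_{≺α}(A) = ⋃_{β ≺₁ α} F_β(A)`. -/
def Flt (E : BoundedExt K B m s n) (α : MIdx m) : Submodule K B :=
  ⨆ β ∈ {β : MIdx m | E.o1.lt β α}, E.F β

/-- The strict order `≺'` on `ℕ^s × ℕ^n`: `(λ,ν) ≺' (λ',ν')` iff `ν ≺ ν'`, or `ν = ν'`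
and `λ ≺₂ λ'`. -/
def ltP (E : BoundedExt K B m s n) (p q : MIdx s × MIdx n) : Prop :=
  E.o.lt p.2 q.2 ∨ (p.2 = q.2 ∧ E.o2.lt p.1 q.1)

end BoundedExt

namespace AdmOrder

variable {n : ℕ} (o : AdmOrder n)

theorem add_left {a b : MIdx n} (c : MIdx n) (h : o.le a b) : o.le (c + a) (c + b) := by
  simpa only [add_comm c] using o.add_right c h

theorem lt_add_right {a b : MIdx n} (c : MIdx n) (h : o.lt a b) : o.lt (a + c) (b + c) :=
  ⟨o.add_right c h.1, fun e => h.2 (add_right_cancel e)⟩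

theorem lt_add_left {a b : MIdx n} (c : MIdx n) (h : o.lt a b) : o.lt (c + a) (c + b) :=
  ⟨o.add_left c h.1, fun e => h.2 (add_left_cancel e)⟩

theorem lt_of_lt_of_le {a b c : MIdx n} (h : o.lt a b) (h' : o.le b c) : o.lt a c :=
  ⟨o.le_trans h.1 h', fun e => h.2 (o.le_antisymm h.1 (e ▸ h'))⟩

theorem lt_of_le_of_lt {a b c : MIdx n} (h : o.le a b) (h' : o.lt b c) : o.lt a c :=
  ⟨o.le_trans h h'.1, fun e => h'.2 (o.le_antisymm h'.1 (e ▸ h))⟩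

theorem le_add_self (a c : MIdx n) : o.le a (c + a) := by
  simpa using o.add_right a (o.zero_le c)

/-- An admissible order refines the componentwise order. -/
theorem le_of_pointwise {a b : MIdx n} (h : a ≤ b) : o.le a b := by
  have := o.le_add_self a (b - a)
  rwa [tsub_add_cancel_of_le h] at this

/-- Admissible orders are well-orders, by Dickson's lemma. -/
theorem wellFounded_lt : WellFounded o.lt := by
  have : IsPreorder (MIdx n) o.le := { refl := o.le_refl, trans := fun _ _ _ => o.le_trans }
  have hw : WellQuasiOrdered o.le := fun f => by
    obtain ⟨i, j, hij, h⟩ := wellQuasiOrdered_le (α := MIdx n) f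
    exact ⟨i, j, hij, o.le_of_pointwise h⟩
  exact Subrelation.wf (fun {a b} (h : o.lt a b) => ⟨h.1, fun h' => h.2 (o.le_antisymm h.1 h')⟩)
    hw.wellFounded

end AdmOrder

/-- Induction on multi-indices, increasing a coordinate that precedes all nonzero ones. -/
theorem MIdx.induction_single_add {s : ℕ} {R : MIdx s → Prop} (zero : R 0)
    (step : ∀ (j : Fin s) (β : MIdx s), (∀ k < j, β k = 0) → R β → R (Pi.single j 1 + β))
    (β : MIdx s) : R β := by
  induction h : ∑ i, β i generalizing β with
  | zero =>
    have : β = 0 := by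
      funext i
      exact Finset.sum_eq_zero_iff.1 h i (Finset.mem_univ i)
    exact this ▸ zero
  | succ N ih =>
    have hne : ∃ j, β j ≠ 0 := by
      by_contra! hc
      simp [hc] at h
    obtain ⟨j, hj, hmin⟩ := WellFounded.has_min (wellFounded_lt (α := Fin s)) {j | β j ≠ 0} hne
    have hle : Pi.single j 1 ≤ β := by
      intro k
      rcases eq_or_ne k j with rfl | hk
      · simpa using Nat.one_le_iff_ne_zero.2 hj
      · simp [hk]
    have hβ : Pi.single j 1 + (β - Pi.single j 1) = β := add_tsub_cancel_of_le hle
    rw [← hβ]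
    refine step j _ (fun k hk => ?_) (ih _ ?_)
    · have : β k = 0 := by
        by_contra hc
        exact hmin k hc hk
      simp [this]
    · rw [← hβ] at h
      simp only [Pi.add_apply, Finset.sum_add_distrib, Finset.sum_pi_single', Finset.mem_univ,
        if_true] at h
      omega

theorem smon_zero {B : Type*} [Monoid B] {s : ℕ} (x : Fin s → B) : smon x 0 = 1 := by
  simp [smon]

theorem smon_succ {B : Type*} [Monoid B] {s : ℕ} (x : Fin (s + 1) → B) (β : MIdx (s + 1)) :
    smon x β = x 0 ^ β 0 * smon (fun i => x i.succ) (fun i => β i.succ) := by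
  simp [smon, List.ofFn_succ]

theorem smon_single_add {B : Type*} [Monoid B] {s : ℕ} (x : Fin s → B) (j : Fin s) (β : MIdx s)
    (h : ∀ k < j, β k = 0) : smon x (Pi.single j 1 + β) = x j * smon x β := by
  induction s with
  | zero => exact j.elim0
  | succ s ih =>
    rw [smon_succ, smon_succ x β]
    cases j using Fin.cases with
    | zero => simp [pow_add, mul_assoc]
    | succ j =>
      have h0 : β 0 = 0 := h 0 (Fin.succ_pos j)
      have := ih (fun i => x i.succ) j (fun i => β i.succ)
        (fun k hk => h k.succ (Fin.succ_lt_succ_iff.2 hk))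
      have e : (fun i : Fin s => (Pi.single j.succ 1 + β : MIdx (s + 1)) i.succ) =
          Pi.single j 1 + fun i => β i.succ := by
        funext i
        simp [Pi.single_apply]
      rw [e, this]
      simp [h0]

section monSum

variable {K : Type*} [CommRing K] {B : Type*} [Ring B] [Algebra K B] {m s : ℕ}
  {F : MIdx m → Submodule K B} {x : Fin s → B} {P Q : MIdx m × MIdx s → Prop}

theorem mul_smon_mem_monSum {a : B} (γ : MIdx m × MIdx s) (hγ : P γ) (ha : a ∈ F γ.1) :
    a * smon x γ.2 ∈ monSum K B F x P :=
  Submodule.mem_iSup_of_mem γ (Submodule.mem_iSup_of_mem hγ ⟨a, ha, rfl⟩)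

theorem monSum_le {S : Submodule K B}
    (h : ∀ γ, P γ → ∀ a ∈ F γ.1, a * smon x γ.2 ∈ S) : monSum K B F x P ≤ S :=
  iSup₂_le fun γ hγ => Submodule.map_le_iff_le_comap.2 fun a ha => h γ hγ a ha

theorem monSum_mono (h : ∀ γ, P γ → Q γ) : monSum K B F x P ≤ monSum K B F x Q :=
  monSum_le fun γ hγ _ ha => mul_smon_mem_monSum γ (h γ hγ) ha

end monSum

namespace BoundedExt

variable {K : Type*} [CommRing K] {B : Type*} [Ring B] [Algebra K B] {m s n : ℕ}
  (E : BoundedExt K B m s n)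

/-- `Σ_{wt(γ) ≺ α} F_{γ₁}(A)x^{γ₂}`. -/
def strictSum (α : MIdx n) : Submodule K B :=
  monSum K B E.F E.x (fun γ => E.o.lt (E.wt γ) α)

theorem strictSum_le_tF (α : MIdx n) : E.strictSum α ≤ E.tF α :=
  monSum_mono fun _ h => h.1

theorem tF_mono {α β : MIdx n} (h : E.o.le α β) : E.tF α ≤ E.tF β :=
  monSum_mono fun _ hγ => E.o.le_trans hγ h

theorem tF_le_strictSum {α β : MIdx n} (h : E.o.lt α β) : E.tF α ≤ E.strictSum β :=
  monSum_mono fun _ hγ => E.o.lt_of_le_of_lt hγ h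

theorem mul_smon_mem_tF {c : MIdx m} {a : B} (ha : a ∈ E.F c) (β : MIdx s) :
    a * smon E.x β ∈ E.tF (E.φ c + E.ψ β) :=
  mul_smon_mem_monSum (c, β) (E.o.le_refl _) ha

theorem smon_mem_tF (β : MIdx s) : smon E.x β ∈ E.tF (E.ψ β) := by
  simpa using E.mul_smon_mem_tF E.F_one β

theorem F_mul_mem_tF {c : MIdx m} {a v : B} {δ : MIdx n} (ha : a ∈ E.F c) (hv : v ∈ E.tF δ) :
    a * v ∈ E.tF (E.φ c + δ) := by
  suffices E.tF δ ≤ (E.tF (E.φ c + δ)).comap (LinearMap.mulLeft K a) from this hv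
  refine monSum_le fun γ hγ b hb => ?_
  change a * (b * smon E.x γ.2) ∈ E.tF (E.φ c + δ)
  rw [← mul_assoc]
  refine mul_smon_mem_monSum (c + γ.1, γ.2) ?_ (E.F_mul ha hb)
  have := E.o.add_left (E.φ c) hγ
  simpa [wt, add_assoc] using this

theorem F_mul_mem_strictSum {c : MIdx m} {a v : B} {δ : MIdx n} (ha : a ∈ E.F c)
    (hv : v ∈ E.strictSum δ) : a * v ∈ E.strictSum (E.φ c + δ) := by
  suffices E.strictSum δ ≤ (E.strictSum (E.φ c + δ)).comap (LinearMap.mulLeft K a) from this hv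
  refine monSum_le fun γ hγ b hb => ?_
  exact E.tF_le_strictSum (E.o.lt_add_left _ hγ) (E.F_mul_mem_tF ha (E.mul_smon_mem_tF hb γ.2))

theorem exists_x_mul_sub_mem (i : Fin s) {α : MIdx m} {a : B} (ha : a ∈ E.F α) :
    ∃ a' ∈ E.F α, E.x i * a - a' * E.x i ∈ E.strictSum (E.φ α + E.ψ (Pi.single i 1)) := by
  obtain ⟨y, ⟨a', ha', rfl⟩, z, hz, h⟩ := Submodule.mem_sup.1 (E.EA3 i α a ha)
  refine ⟨a', ha', ?_⟩
  rw [← h, LinearMap.mulRight_apply, add_sub_cancel_left]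
  exact hz

/-- The family `F̃` is multiplicative in total weight less than `w`. -/
def MulBelow (w : MIdx n) : Prop :=
  ∀ γ δ, E.o.lt (γ + δ) w → ∀ u ∈ E.tF γ, ∀ v ∈ E.tF δ, u * v ∈ E.tF (γ + δ)

variable {E} {w : MIdx n}

theorem MulBelow.strictSum_mul (H : E.MulBelow w) {γ δ : MIdx n} (hw : E.o.le (γ + δ) w) {u v : B}
    (hu : u ∈ E.strictSum γ) (hv : v ∈ E.tF δ) : u * v ∈ E.strictSum (γ + δ) := by
  suffices E.strictSum γ ≤ (E.strictSum (γ + δ)).comap (LinearMap.mulRight K v) from this hu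
  refine monSum_le fun c hc a ha => ?_
  have hlt := E.o.lt_add_right δ hc
  exact E.tF_le_strictSum hlt
    (H _ _ (E.o.lt_of_lt_of_le hlt hw) _ (E.mul_smon_mem_tF ha c.2) v hv)

theorem MulBelow.mul_strictSum (H : E.MulBelow w) {γ δ : MIdx n} (hw : E.o.le (γ + δ) w) {u v : B}
    (hu : u ∈ E.tF γ) (hv : v ∈ E.strictSum δ) : u * v ∈ E.strictSum (γ + δ) := by
  suffices E.strictSum δ ≤ (E.strictSum (γ + δ)).comap (LinearMap.mulLeft K u) from this hv
  refine monSum_le fun c hc a ha => ?_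
  have hlt := E.o.lt_add_left γ hc
  exact E.tF_le_strictSum hlt
    (H _ _ (E.o.lt_of_lt_of_le hlt hw) u hu _ (E.mul_smon_mem_tF ha c.2))

variable (E) in
theorem x_mem_tF (i : Fin s) : E.x i ∈ E.tF (E.ψ (Pi.single i 1)) := by
  have h := smon_single_add E.x i 0 (fun _ _ => rfl)
  rw [add_zero, smon_zero, mul_one] at h
  exact h ▸ E.smon_mem_tF (Pi.single i 1)

/-- Reordering `x_i x^β` into a standard monomial, modulo terms of smaller weight. -/
theorem MulBelow.exists_x_mul_smon_sub_mem (H : E.MulBelow w) (β : MIdx s) :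
    ∀ i, E.o.le (E.ψ (Pi.single i 1 + β)) w →
      ∃ q ∈ E.F 0, E.x i * smon E.x β - q * smon E.x (Pi.single i 1 + β) ∈
        E.strictSum (E.ψ (Pi.single i 1 + β)) := by
  have direct : ∀ (β : MIdx s) (i : Fin s), (∀ k < i, β k = 0) →
      ∃ q ∈ E.F 0, E.x i * smon E.x β - q * smon E.x (Pi.single i 1 + β) ∈
        E.strictSum (E.ψ (Pi.single i 1 + β)) := fun β i h =>
    ⟨1, E.F_one, by simp [smon_single_add E.x i β h]⟩
  induction β using MIdx.induction_single_add with
  | zero => exact fun i _ => direct 0 i fun _ _ => rfl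
  | step j β hj ih =>
    intro i hi
    rcases le_or_gt i j with hij | hji
    · refine direct _ i fun k hk => ?_
      have hkj := lt_of_lt_of_le hk hij
      simp [hj k hkj, hkj.ne]
    have hT : E.ψ (Pi.single i 1 + (Pi.single j 1 + β)) =
        E.ψ (Pi.single j 1) + E.ψ (Pi.single i 1 + β) := by
      simp only [map_add]; abel
    have hT' : E.ψ (Pi.single i 1 + (Pi.single j 1 + β)) =
        E.ψ (Pi.single j 1 + Pi.single i 1) + E.ψ β := by
      simp only [map_add]; abel
    have hs : smon E.x (Pi.single i 1 + (Pi.single j 1 + β)) =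
        E.x j * smon E.x (Pi.single i 1 + β) := by
      rw [add_left_comm, smon_single_add]
      intro k hk
      simp [hj k hk, (hk.trans hji).ne]
    have hle := hi
    rw [hT] at hle
    have hle' := hi
    rw [hT'] at hle'
    obtain ⟨q, hq, hq_mem⟩ := E.EA4 j i hji
    obtain ⟨q', hq', hq'_mem⟩ := ih i (E.o.le_trans (E.o.le_add_self _ _) hle)
    obtain ⟨q'', hq'', hq''_mem⟩ := E.exists_x_mul_sub_mem j hq'
    rw [map_zero, zero_add] at hq''_mem
    have h₁ := H.strictSum_mul hle' hq_mem (E.smon_mem_tF β)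
    have h₂ := H.mul_strictSum hle (E.x_mem_tF j) hq'_mem
    have h₃ := H.strictSum_mul hle hq''_mem (E.smon_mem_tF (Pi.single i 1 + β))
    have h₄ := E.F_mul_mem_strictSum hq (add_mem h₂ h₃)
    rw [map_zero, zero_add, ← hT] at h₄
    rw [← hT'] at h₁
    refine ⟨q * q'', by simpa using E.F_mul hq hq'', ?_⟩
    rw [hs, smon_single_add E.x j β hj]
    convert add_mem h₁ h₄ using 1
    noncomm_ring

theorem MulBelow.x_mul_mem (H : E.MulBelow w) (i : Fin s) {δ : MIdx n}
    (hw : E.o.le (E.ψ (Pi.single i 1) + δ) w) {v : B} (hv : v ∈ E.tF δ) :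
    E.x i * v ∈ E.tF (E.ψ (Pi.single i 1) + δ) := by
  suffices E.tF δ ≤ (E.tF (E.ψ (Pi.single i 1) + δ)).comap (LinearMap.mulLeft K (E.x i)) from
    this hv
  refine monSum_le fun γ hγ b hb => ?_
  have hγ' := E.o.add_left (E.ψ (Pi.single i 1)) hγ
  have hle := E.o.le_trans hγ' hw
  have hT : E.ψ (Pi.single i 1) + E.wt γ = E.φ γ.1 + E.ψ (Pi.single i 1) + E.ψ γ.2 := by
    simp only [wt]; abel
  have hT' : E.ψ (Pi.single i 1) + E.wt γ = E.φ γ.1 + E.ψ (Pi.single i 1 + γ.2) := by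
    simp only [wt, map_add]; abel
  refine E.tF_mono hγ' ?_
  change E.x i * (b * smon E.x γ.2) ∈ E.tF (E.ψ (Pi.single i 1) + E.wt γ)
  obtain ⟨b', hb', hb'_mem⟩ := E.exists_x_mul_sub_mem i hb
  have hle' := hle
  rw [hT'] at hle'
  obtain ⟨q, hq, hq_mem⟩ :=
    H.exists_x_mul_smon_sub_mem γ.2 i (E.o.le_trans (E.o.le_add_self _ _) hle')
  have h₁ := E.strictSum_le_tF _ (H.strictSum_mul (hT ▸ hle) hb'_mem (E.smon_mem_tF γ.2))
  have h₂ := E.F_mul_mem_tF hb' (E.strictSum_le_tF _ hq_mem)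
  have h₃ := E.F_mul_mem_tF hb' (E.F_mul_mem_tF hq (E.smon_mem_tF (Pi.single i 1 + γ.2)))
  rw [← hT] at h₁
  rw [← hT'] at h₂
  rw [map_zero, zero_add, ← hT'] at h₃
  convert add_mem h₁ (add_mem h₂ h₃) using 1
  noncomm_ring

theorem MulBelow.smon_mul_mem (H : E.MulBelow w) (β : MIdx s) {δ : MIdx n}
    (hw : E.o.le (E.ψ β + δ) w) {v : B} (hv : v ∈ E.tF δ) :
    smon E.x β * v ∈ E.tF (E.ψ β + δ) := by
  induction β using MIdx.induction_single_add with
  | zero => simpa [smon_zero] using hv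
  | step j β hj ih =>
    rw [map_add, add_assoc] at hw ⊢
    rw [smon_single_add E.x j β hj, mul_assoc]
    exact H.x_mul_mem j hw (ih (E.o.le_trans (E.o.le_add_self _ _) hw))

theorem MulBelow.mul_mem (H : E.MulBelow w) {γ δ : MIdx n} (hw : E.o.le (γ + δ) w) {u v : B}
    (hu : u ∈ E.tF γ) (hv : v ∈ E.tF δ) : u * v ∈ E.tF (γ + δ) := by
  suffices E.tF γ ≤ (E.tF (γ + δ)).comap (LinearMap.mulRight K v) from this hu
  refine monSum_le fun c hc a ha => ?_
  change a * smon E.x c.2 * v ∈ E.tF (γ + δ)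
  have hc' := E.o.add_right δ hc
  have hle := E.o.le_trans hc' hw
  rw [wt, add_assoc] at hc' hle
  rw [mul_assoc]
  exact E.tF_mono hc' (E.F_mul_mem_tF ha
    (H.smon_mul_mem c.2 (E.o.le_trans (E.o.le_add_self _ _) hle) hv))

variable (E)

theorem mulBelow (w : MIdx n) : E.MulBelow w := by
  induction w using E.o.wellFounded_lt.induction with
  | _ w ih => exact fun γ δ h u hu v hv => (ih _ h).mul_mem (E.o.le_refl _) hu hv

theorem tF_mul_mem {γ δ : MIdx n} {u v : B} (hu : u ∈ E.tF γ) (hv : v ∈ E.tF δ) :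
    u * v ∈ E.tF (γ + δ) :=
  (E.mulBelow _).mul_mem (E.o.le_refl _) hu hv

theorem F_le_tF (c : MIdx m) : E.F c ≤ E.tF (E.φ c) := fun a ha => by
  simpa [smon_zero] using E.mul_smon_mem_tF ha 0

theorem exists_mem_tF (b : B) : ∃ α, b ∈ E.tF α := by
  have hA : ∀ a ∈ E.A, ∃ α, a ∈ E.tF α := fun a ha =>
    let ⟨c, hc⟩ := E.F_exhaustive a ha
    ⟨E.φ c, E.F_le_tF c hc⟩
  have hb : b ∈ Algebra.adjoin K ((E.A : Set B) ∪ Set.range E.x) := E.gen ▸ Algebra.mem_top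
  induction hb using Algebra.adjoin_induction with
  | mem y hy =>
    rcases hy with hy | ⟨i, rfl⟩
    · exact hA y hy
    · exact ⟨_, E.x_mem_tF i⟩
  | algebraMap r => exact hA _ (E.A.algebraMap_mem r)
  | add y z _ _ hy hz =>
    obtain ⟨α, hα⟩ := hy
    obtain ⟨β, hβ⟩ := hz
    rcases E.o.le_total α β with h | h
    · exact ⟨β, add_mem (E.tF_mono h hα) hβ⟩
    · exact ⟨α, add_mem hα (E.tF_mono h hβ)⟩
  | mul y z _ _ hy hz =>
    obtain ⟨α, hα⟩ := hy
    obtain ⟨β, hβ⟩ := hz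
    exact ⟨α + β, E.tF_mul_mem hα hβ⟩

end BoundedExt

/-- **Proposition (esfiltracion).** For a `(φ,ψ)`-bounded extension `A ⊆ B`, the family
`𝔉 = { F̃_α(B) }_{α ∈ ℕ^n}`, with `F̃_α(B) = Σ_{wt(γ) ⪯ α} F_{γ₁}(A)x^{γ₂}`, is an
`(ℕ^n,⪯)`-filtration on `B`: it is monotone, multiplicative, exhaustive, and `1 ∈ F̃_0(B)`. -/
theorem boundedExt_tF_isFiltration {K : Type*} [CommRing K] {B : Type*} [Ring B]
    [Algebra K B] {m s n : ℕ} (E : BoundedExt K B m s n) :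
    (∀ α β : MIdx n, E.o.le α β → E.tF α ≤ E.tF β) ∧
    (∀ γ δ : MIdx n, ∀ u ∈ E.tF γ, ∀ v ∈ E.tF δ, u * v ∈ E.tF (γ + δ)) ∧
    (∀ b : B, ∃ α : MIdx n, b ∈ E.tF α) ∧
    (1 : B) ∈ E.tF 0 := by
  exact ⟨fun _ _ h => E.tF_mono h, fun _ _ _ hu _ hv => E.tF_mul_mem hu hv, E.exists_mem_tF,
    by simpa using E.F_le_tF 0 E.F_one⟩
end

section
/- Let A ⊆ B be a (φ,ψ)-bounded extension of the multi-filtered K-algebra A with φ injective. Then the homomorphism f : G(A) → G(B) is injective if and only if no nonzero a ∈ A admits an expression a = Σ a^{β₁} x^{β₂}, a finite sum over pairs (β₁,β₂) ∈ ℕ^m × ℕ^s with wt(β₁,β₂) ≺ φ(mdeg_F(a)) and a^{β₁} ∈ F_{β₁}(A). -/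
open scoped BigOperators

theorem AdmOrder.le_of_not_lt {n : ℕ} (o : AdmOrder n) {a b : MIdx n} (h : ¬ o.lt b a) :
    o.le a b := by
  rcases o.le_total a b with h' | h'
  · exact h'
  · by_cases hab : b = a
    · exact hab ▸ o.le_refl b
    · exact absurd ⟨h', hab⟩ h

theorem AdmOrder.lt_of_le_of_lt_s10 {n : ℕ} (o : AdmOrder n) {a b c : MIdx n} (hab : o.le a b)
    (hbc : o.lt b c) : o.lt a c := by
  refine ⟨o.le_trans hab hbc.1, ?_⟩
  rintro rfl
  exact hbc.2 (o.le_antisymm hbc.1 hab)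

namespace BoundedExt

variable {K : Type*} [CommRing K] {B : Type*} [Ring B] [Algebra K B] {m s n : ℕ}

/-- The supremum defining `F_{≺α}(A)` is a union, up to the zero element. -/
theorem eq_zero_or_exists_of_mem_Flt (E : BoundedExt K B m s n) {α : MIdx m} {a : B}
    (ha : a ∈ E.Flt α) : a = 0 ∨ ∃ β, E.o1.lt β α ∧ a ∈ E.F β := by
  rw [Flt, iSup_subtype'] at ha
  induction ha using Submodule.iSup_induction' with
  | mem i x hx => exact Or.inr ⟨i, i.2, hx⟩
  | zero => exact Or.inl rfl
  | add x y _ _ hx hy =>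
    rcases hx with rfl | ⟨β, hβ, hx⟩
    · simpa using hy
    rcases hy with rfl | ⟨γ, hγ, hy⟩
    · exact Or.inr ⟨β, hβ, by simpa using hx⟩
    rcases E.o1.le_total β γ with h | h
    · exact Or.inr ⟨γ, hγ, add_mem (E.F_mono h hx) hy⟩
    · exact Or.inr ⟨β, hβ, add_mem hx (E.F_mono h hy)⟩

/-- `F̃_{≺α}(B)` is the sum of the `F_{γ₁}(A)x^{γ₂}` with `wt(γ) ≺ α`. -/
theorem tFlt_eq_monSum (E : BoundedExt K B m s n) (α : MIdx n) :
    E.tFlt α = monSum K B E.F E.x (fun γ => E.o.lt (E.wt γ) α) := by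
  apply le_antisymm
  · refine iSup₂_le fun β hβ => iSup₂_le fun γ hγ => ?_
    exact le_iSup₂_of_le γ (E.o.lt_of_le_of_lt_s10 hγ hβ) le_rfl
  · refine iSup₂_le fun γ hγ => ?_
    exact le_iSup₂_of_le (E.wt γ) hγ (le_iSup₂_of_le γ (E.o.le_refl _) le_rfl)

end BoundedExt

/-- **Lemma (noinyl).** Let `A ⊆ B` be a `(φ,ψ)`-bounded extension with `φ` injective.  The
homomorphism `f : G(A) → G(B)` is injective (i.e. on each homogeneous component: every
`a ∈ F_α(A)` whose class dies in `G(B)` — that is, `a ∈ F̃_{≺φ(α)}(B)` — already satisfies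
`a ∈ F_{≺α}(A)`) if and only if no nonzero `a ∈ A`, with multidegree `d = mdeg_F(a)`,
admits an expression `a = Σ a^{β₁}x^{β₂}` over pairs `(β₁,β₂)` with
`wt(β₁,β₂) ≺ φ(d)` and `a^{β₁} ∈ F_{β₁}(A)`. -/
theorem boundedExt_graded_map_injective_iff {K : Type*} [CommRing K] {B : Type*} [Ring B]
    [Algebra K B] {m s n : ℕ} (E : BoundedExt K B m s n)
    (hφ : Function.Injective E.φ) :
    (∀ α : MIdx m, ∀ a ∈ E.F α, a ∈ E.tFlt (E.φ α) → a ∈ E.Flt α) ↔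
      ¬ ∃ (a : B) (d : MIdx m), a ≠ 0 ∧ a ∈ E.F d ∧ (∀ d', a ∈ E.F d' → E.o1.le d d') ∧
        a ∈ monSum K B E.F E.x (fun β => E.o.lt (E.wt β) (E.φ d)) := by
  constructor
  · rintro h ⟨a, d, ha, had, hmin, hsum⟩
    rw [← E.tFlt_eq_monSum] at hsum
    rcases E.eq_zero_or_exists_of_mem_Flt (h d a had hsum) with h0 | ⟨β, hβ, haβ⟩
    · exact ha h0
    · exact hβ.2 (E.o1.le_antisymm hβ.1 (hmin β haβ))
  · intro h α a haα hat
    by_contra hn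
    refine h ⟨a, α, ?_, haα, fun d' hd' => E.o1.le_of_not_lt fun hlt => hn ?_, ?_⟩
    · rintro rfl
      exact hn (zero_mem _)
    · exact (le_iSup₂_of_le (f := fun β (_ : β ∈ {β | E.o1.lt β α}) => E.F β)
        d' hlt le_rfl) hd'
    · rwa [← E.tFlt_eq_monSum]
end
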